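/- Let F be a perfect field of characteristic p ≥ 3; since F is perfect every d ∈ F∖{0} has a unique p-th root d^{1/p}. Define a relation ~ on F⁴ by: (α1,α2,β1,β2) ~ (α1',α2',β1',β2') if and only if there exist a11, a12, a21, a22 ∈ F with d := a11a22 − a12a21 ≠ 0 and t, c1, c2 ∈ F such that α1' = d^{-1}(α1·a11^p + α2·a12^p + c1^p) − t·(β1·a11^p + β2·a12^p), α2' = d^{-1}(α1·a21^p + α2·a22^p + c2^p) − t·(β1·a21^p + β2·a22^p), β1' = d^{-1/p}(β1·a11^p + β2·a12^p), and β2' = d^{-1/p}(β1·a21^p + β2·a22^p). Then ~ is the orbit relation of a group action on F⁴ with exactly two orbits: (α1,α2,β1,β2) is related to (0,0,0,0) if and only if (β1,β2) = (0,0), and it is related to (0,0,0,1) if and only if (β1,β2) ≠ (0,0). -/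

import Mathlib

/-- The orbit relation on tuples `(α1, α2, β1, β2) ∈ F⁴` parametrizing the
`[p]`-nilpotent restricted structures on `L_{4,2}` with `x4^[p] = x3`,
`x3^[p] = 0`, induced by the automorphisms of `L_{4,2}` preserving this behaviour
on the center.  Here `e` is the (unique, by perfectness) `p`-th root of the
determinant `d`, so `e⁻¹ = d^{-1/p}`. -/
def rel42x4 {F : Type*} [Field F] (p : ℕ) (v w : F × F × F × F) : Prop :=
  ∃ a11 a12 a21 a22 t c1 c2 e : F,
    a11 * a22 - a12 * a21 ≠ 0 ∧
    e ^ p = a11 * a22 - a12 * a21 ∧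
    w.1 = (a11 * a22 - a12 * a21)⁻¹ * (v.1 * a11 ^ p + v.2.1 * a12 ^ p + c1 ^ p) -
        t * (v.2.2.1 * a11 ^ p + v.2.2.2 * a12 ^ p) ∧
    w.2.1 = (a11 * a22 - a12 * a21)⁻¹ * (v.1 * a21 ^ p + v.2.1 * a22 ^ p + c2 ^ p) -
        t * (v.2.2.1 * a21 ^ p + v.2.2.2 * a22 ^ p) ∧
    w.2.2.1 = e⁻¹ * (v.2.2.1 * a11 ^ p + v.2.2.2 * a12 ^ p) ∧
    w.2.2.2 = e⁻¹ * (v.2.2.1 * a21 ^ p + v.2.2.2 * a22 ^ p)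

/-- A nonzero vector of `F²` is the first column of a matrix of determinant one. -/
lemma exists_mul_sub_mul_eq_one {F : Type*} [Field F] {x y : F} (h : ¬ (x = 0 ∧ y = 0)) :
    ∃ r s : F, x * s - y * r = 1 := by
  by_cases hx : x = 0
  · have hy : y ≠ 0 := fun hy => h ⟨hx, hy⟩
    exact ⟨-y⁻¹, 0, by field_simp; ring⟩
  · exact ⟨0, x⁻¹, by field_simp; ring⟩

/-- `SL₂(F)` acts transitively on the nonzero vectors of `F²`. -/
lemma exists_det_one_mapsTo {F : Type*} [Field F] {x y z w : F} (h : ¬ (x = 0 ∧ y = 0))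
    (h' : ¬ (z = 0 ∧ w = 0)) :
    ∃ a b c d : F, a * d - b * c = 1 ∧ a * x + b * y = z ∧ c * x + d * y = w := by
  obtain ⟨r, s, hrs⟩ := exists_mul_sub_mul_eq_one h
  obtain ⟨r', s', hrs'⟩ := exists_mul_sub_mul_eq_one h'
  refine ⟨z * s - r' * y, r' * x - z * r, w * s - s' * y, s' * x - w * r, ?_, ?_, ?_⟩
  · linear_combination (z * s' - w * r') * hrs + hrs'
  · linear_combination z * hrs
  · linear_combination w * hrs

/-- Two tuples are related exactly when their `β`-parts vanish simultaneously. -/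
lemma rel42x4_iff {F : Type*} [Field F] (p : ℕ) [Fact p.Prime] [CharP F p]
    (hperf : Function.Surjective fun c : F => c ^ p) (v w : F × F × F × F) :
    rel42x4 p v w ↔ ((v.2.2.1 = 0 ∧ v.2.2.2 = 0) ↔ (w.2.2.1 = 0 ∧ w.2.2.2 = 0)) := by
  have hp : p ≠ 0 := (Fact.out : p.Prime).ne_zero
  obtain ⟨α₁, α₂, β₁, β₂⟩ := v
  obtain ⟨γ₁, γ₂, δ₁, δ₂⟩ := w
  constructor
  · rintro ⟨a, b, c, d, t, c₁, c₂, e, hd, he, -, -, h₁, h₂⟩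
    simp only at h₁ h₂ ⊢
    have he0 : e ≠ 0 := by
      rintro rfl
      exact hd (by rw [← he, zero_pow hp])
    have hdet : a ^ p * d ^ p - b ^ p * c ^ p ≠ 0 := by
      rw [← mul_pow, ← mul_pow, ← sub_pow_char]
      exact pow_ne_zero p hd
    constructor
    · rintro ⟨rfl, rfl⟩
      simp [h₁, h₂]
    · rintro ⟨rfl, rfl⟩
      have k₁ := (mul_eq_zero.mp h₁.symm).resolve_left (inv_ne_zero he0)
      have k₂ := (mul_eq_zero.mp h₂.symm).resolve_left (inv_ne_zero he0)
      constructor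
      · refine (mul_eq_zero.mp ?_).resolve_left hdet
        linear_combination d ^ p * k₁ - b ^ p * k₂
      · refine (mul_eq_zero.mp ?_).resolve_left hdet
        linear_combination a ^ p * k₂ - c ^ p * k₁
  · intro h
    simp only at h
    obtain ⟨a, b, c, d, hd, h₁, h₂⟩ : ∃ a b c d : F, a * d - b * c = 1 ∧
        β₁ * a ^ p + β₂ * b ^ p = δ₁ ∧ β₁ * c ^ p + β₂ * d ^ p = δ₂ := by
      by_cases hβ : β₁ = 0 ∧ β₂ = 0
      · obtain ⟨hδ₁, hδ₂⟩ := h.mp hβ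
        exact ⟨1, 0, 0, 1, by ring, by simp [hβ, hδ₁], by simp [hβ, hδ₂]⟩
      · have hδ := fun k => hβ (h.mpr k)
        obtain ⟨x, rfl⟩ := hperf β₁
        obtain ⟨y, rfl⟩ := hperf β₂
        obtain ⟨z, rfl⟩ := hperf δ₁
        obtain ⟨w, rfl⟩ := hperf δ₂
        simp only [pow_eq_zero_iff hp] at hβ hδ
        obtain ⟨a, b, c, d, hd, rfl, rfl⟩ := exists_det_one_mapsTo hβ hδ
        exact ⟨a, b, c, d, hd, by simp only [add_pow_char, mul_pow]; ring,
          by simp only [add_pow_char, mul_pow]; ring⟩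
    obtain ⟨c₁, hc₁⟩ := hperf (γ₁ - (α₁ * a ^ p + α₂ * b ^ p))
    obtain ⟨c₂, hc₂⟩ := hperf (γ₂ - (α₁ * c ^ p + α₂ * d ^ p))
    simp only at hc₁ hc₂
    refine ⟨a, b, c, d, 0, c₁, c₂, 1, ?_, ?_, ?_, ?_, ?_, ?_⟩ <;> simp [hd, hc₁, hc₂, h₁, h₂]

/-- Over a perfect field of characteristic `p ≥ 3` the relation `rel42x4` is an
equivalence relation with exactly two classes: that of `(0,0,0,0)`, consisting of
the tuples with `(β1, β2) = (0, 0)`, and that of `(0,0,0,1)`, consisting of the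
tuples with `(β1, β2) ≠ (0, 0)`. -/
theorem l42_x4_to_x3_two_orbits
    (F : Type*) [Field F] (p : ℕ) [CharP F p] (hp3 : 3 ≤ p)
    (hperf : Function.Surjective fun c : F => c ^ p) :
    Equivalence (rel42x4 (F := F) p) ∧
      (∀ v : F × F × F × F,
        rel42x4 p v ((0, 0, 0, 0) : F × F × F × F) ↔ v.2.2.1 = 0 ∧ v.2.2.2 = 0) ∧
      (∀ v : F × F × F × F,
        rel42x4 p v ((0, 0, 0, 1) : F × F × F × F) ↔ ¬ (v.2.2.1 = 0 ∧ v.2.2.2 = 0)) := by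
  have : Fact p.Prime :=
    ⟨(CharP.char_is_prime_or_zero F p).resolve_right (by omega)⟩
  have key := rel42x4_iff p hperf
  refine ⟨⟨fun v => (key v v).mpr Iff.rfl, fun {v w} h => (key w v).mpr ((key v w).mp h).symm,
    fun {u v w} h h' => (key u w).mpr (((key u v).mp h).trans ((key v w).mp h'))⟩,
    fun v => ?_, fun v => ?_⟩ <;> simp [key]
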